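/- arXiv:2604.19861 — 4 statements merged into one kernel-verified Lean document; each statement's English description precedes it below -/
import Mathlib

section
/- Let K₁ and K₂ be complex Hilbert spaces. Let R₁ be a bounded operator on K₁ with R₁† = −R₁ and R₁ ∘ R₁ = −1, and let R₂ be a bounded operator on K₂ with R₂† = −R₂ and R₂ ∘ R₂ = −1. Let L : K₁ → K₂ be a bounded bijective linear map with L† ∘ R₂ ∘ L = R₁, and set Q := L† ∘ L. Then the operators X₁ := 1 − i·R₁ and X₂ := Q − i·R₁ on K₁ are positive, and if X₂ − X₁ = Q − 1 is Hilbert–Schmidt, then √X₂ − √X₁ is Hilbert–Schmidt. -/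
noncomputable section

universe u v w

/-- A bounded linear operator between complex Hilbert spaces is **Hilbert–Schmidt** if for some
(equivalently, every) Hilbert orthonormal basis `(e i)` of its domain, the family
`i ↦ ‖T (e i)‖ ^ 2` is summable. -/
def IsHilbertSchmidt {E : Type u} {F : Type v} [NormedAddCommGroup E] [InnerProductSpace ℂ E]
    [NormedAddCommGroup F] [InnerProductSpace ℂ F] (T : E →L[ℂ] F) : Prop :=
  ∃ (ι : Type u) (b : HilbertBasis ι ℂ E), Summable fun i => ‖T (b i)‖ ^ 2

/-- The square root of a (positive) bounded operator on a complex Hilbert space, given by the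
continuous functional calculus applied to `Real.sqrt`; for a positive operator this is its
unique positive square root. -/
noncomputable def opSqrt {H : Type u} [NormedAddCommGroup H] [InnerProductSpace ℂ H]
    [CompleteSpace H] (A : H →L[ℂ] H) : H →L[ℂ] H :=
  cfc Real.sqrt A

open scoped InnerProductSpace

namespace ContinuousLinearMap

/-- For a fixed Hilbert basis, square-summability of an operator passes to its adjoint. -/
theorem summable_norm_sq_adjoint {E : Type u} [NormedAddCommGroup E] [InnerProductSpace ℂ E]
    [CompleteSpace E] {ι : Type w} (b : HilbertBasis ι ℂ E) {T : E →L[ℂ] E}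
    (hT : Summable fun i => ‖T (b i)‖ ^ 2) :
    Summable fun i => ‖adjoint T (b i)‖ ^ 2 := by
  have parseval (x : E) : HasSum (fun j => ‖⟪b j, x⟫_ℂ‖ ^ 2) (‖x‖ ^ 2) := by
    have h := Complex.hasSum_re (b.hasSum_inner_mul_inner x x)
    have hterm (j : ι) : (⟪x, b j⟫_ℂ * ⟪b j, x⟫_ℂ).re = ‖⟪b j, x⟫_ℂ‖ ^ 2 := by
      rw [← RCLike.re_eq_complex_re, inner_mul_symm_re_eq_norm, norm_mul, norm_inner_symm x, sq]
    have hself : (⟪x, x⟫_ℂ).re = ‖x‖ ^ 2 := inner_self_eq_norm_sq (𝕜 := ℂ) x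
    simpa only [hterm, hself] using h
  let f : ι × ι → ℝ := fun p => ‖⟪b p.2, T (b p.1)⟫_ℂ‖ ^ 2
  have hf : 0 ≤ f := fun _ => sq_nonneg _
  have hrow (i : ι) : HasSum (fun j => f (i, j)) (‖T (b i)‖ ^ 2) := parseval (T (b i))
  have hcol (j : ι) : HasSum (fun i => f (i, j)) (‖adjoint T (b j)‖ ^ 2) := by
    have h := parseval (adjoint T (b j))
    simp only [adjoint_inner_right] at h
    simpa only [f, norm_inner_symm (b j)] using h
  have hprod : Summable f := by
    refine (summable_prod_of_nonneg hf).2 ⟨fun i => (hrow i).summable, ?_⟩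
    simpa only [(hrow _).tsum_eq] using hT
  have hsymm := ((summable_prod_of_nonneg (f := fun p => f p.swap) fun p => hf p.swap).1
    hprod.prod_symm).2
  simpa only [Prod.swap_prod_mk, (hcol _).tsum_eq] using hsymm

/-- For a fixed Hilbert basis, square-summability is stable under composition on the right with
a bounded operator. -/
theorem summable_norm_sq_mul_right {E : Type u} [NormedAddCommGroup E] [InnerProductSpace ℂ E]
    [CompleteSpace E] {ι : Type w} (b : HilbertBasis ι ℂ E) {T : E →L[ℂ] E}
    (hT : Summable fun i => ‖T (b i)‖ ^ 2) (S : E →L[ℂ] E) :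
    Summable fun i => ‖(T * S) (b i)‖ ^ 2 := by
  have h : Summable fun i => ‖adjoint (T * S) (b i)‖ ^ 2 := by
    refine Summable.of_nonneg_of_le (fun _ => sq_nonneg _) (fun i => ?_)
      ((summable_norm_sq_adjoint b hT).mul_left (‖adjoint S‖ ^ 2))
    rw [mul_def, adjoint_comp, comp_apply, ← mul_pow]
    gcongr
    exact le_opNorm _ _
  simpa only [adjoint_adjoint] using summable_norm_sq_adjoint b h

section Complexified

variable {H : Type u} [NormedAddCommGroup H] [InnerProductSpace ℂ H] [CompleteSpace H]
  {R : H →L[ℂ] H}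

theorem adjoint_one_sub_I_smul (hadj : adjoint R = -R) :
    adjoint (1 - Complex.I • R) = 1 - Complex.I • R := by
  rw [map_sub, map_smulₛₗ, hadj, ← star_eq_adjoint, star_one]
  simp

theorem one_sub_I_smul_mul_self {H : Type u} [NormedAddCommGroup H] [InnerProductSpace ℂ H]
    {R : H →L[ℂ] H} (hsq : R * R = -1) :
    (1 - Complex.I • R) * (1 - Complex.I • R) = (2 : ℂ) • (1 - Complex.I • R) := by
  rw [sub_mul, mul_sub, mul_sub, smul_mul_smul_comm, hsq, Complex.I_mul_I]
  simp only [one_mul, mul_one, neg_smul, one_smul, neg_neg]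
  module

theorem inner_one_sub_I_smul (hadj : adjoint R = -R) (hsq : R * R = -1) (x : H) :
    2 * ⟪x, (1 - Complex.I • R) x⟫_ℂ = (‖(1 - Complex.I • R) x‖ : ℂ) ^ 2 := by
  have h := inner_self_eq_norm_sq_to_K (𝕜 := ℂ) ((1 - Complex.I • R) x)
  rw [← adjoint_inner_right, adjoint_one_sub_I_smul hadj, ← comp_apply, ← mul_def,
    one_sub_I_smul_mul_self hsq, smul_apply, inner_smul_right] at h
  exact h

theorem isPositive_one_sub_I_smul (hadj : adjoint R = -R) (hsq : R * R = -1) :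
    (1 - Complex.I • R).IsPositive := by
  rw [isPositive_iff_complex]
  intro x
  have h : ⟪(1 - Complex.I • R) x, x⟫_ℂ = ((‖(1 - Complex.I • R) x‖ ^ 2 / 2 : ℝ) : ℂ) := by
    rw [← adjoint_inner_right, adjoint_one_sub_I_smul hadj]
    rw [Complex.ofReal_div, Complex.ofReal_pow, ← inner_one_sub_I_smul hadj hsq,
      Complex.ofReal_ofNat]
    ring
  rw [h]
  refine ⟨by rw [RCLike.re_to_complex, Complex.ofReal_re], ?_⟩
  simp only [RCLike.re_to_complex, Complex.ofReal_re]
  positivity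

end Complexified

section Sqrt

variable {H : Type u} [NormedAddCommGroup H] [InnerProductSpace ℂ H] [CompleteSpace H]
  {A : H →L[ℂ] H}

theorem IsPositive.opSqrt_eq_sqrt (hA : A.IsPositive) : opSqrt A = CFC.sqrt A := by
  rw [CFC.sqrt_eq_real_sqrt A ((nonneg_iff_isPositive A).2 hA), cfcₙ_eq_cfc]
  rfl

theorem isPositive_opSqrt (hA : A.IsPositive) : (opSqrt A).IsPositive := by
  rw [hA.opSqrt_eq_sqrt, ← nonneg_iff_isPositive]
  exact CFC.sqrt_nonneg A

theorem opSqrt_mul_self (hA : A.IsPositive) : opSqrt A * opSqrt A = A := by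
  rw [hA.opSqrt_eq_sqrt]
  exact CFC.sqrt_mul_sqrt_self A ((nonneg_iff_isPositive A).2 hA)

theorem opSqrt_eq_of_mul_self {B : H →L[ℂ] H} (hA : A.IsPositive) (hB : B.IsPositive)
    (h : B * B = A) : opSqrt A = B := by
  rw [hA.opSqrt_eq_sqrt]
  exact CFC.sqrt_unique h ((nonneg_iff_isPositive B).2 hB)

theorem norm_opSqrt_apply_sq (hA : A.IsPositive) (x : H) :
    (‖opSqrt A x‖ : ℂ) ^ 2 = ⟪x, A x⟫_ℂ := by
  have h := inner_self_eq_norm_sq_to_K (𝕜 := ℂ) (opSqrt A x)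
  rw [← adjoint_inner_right, (isPositive_opSqrt hA).isSelfAdjoint.adjoint_eq,
    ← comp_apply, ← mul_def,
    opSqrt_mul_self hA] at h
  exact h.symm

/-- A positive operator shifted by a real scalar `c` is bounded below by `c`. -/
theorem IsPositive.mul_norm_le_norm_add_smul {H : Type u} [NormedAddCommGroup H]
    [InnerProductSpace ℂ H] {A : H →L[ℂ] H} (hA : A.IsPositive) {c : ℝ} (x : H) :
    c * ‖x‖ ≤ ‖A x + (c : ℂ) • x‖ := by
  rcases eq_or_ne x 0 with rfl | hx
  · simp
  have hpos : 0 ≤ (⟪x, A x⟫_ℂ).re := hA.re_inner_nonneg_right x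
  have hle : (⟪x, A x + (c : ℂ) • x⟫_ℂ).re ≤ ‖x‖ * ‖A x + (c : ℂ) • x‖ :=
    (Complex.re_le_norm _).trans (norm_inner_le_norm _ _)
  have hself : (⟪x, x⟫_ℂ).re = ‖x‖ ^ 2 := inner_self_eq_norm_sq (𝕜 := ℂ) x
  rw [inner_add_right, inner_smul_right, Complex.add_re, Complex.re_ofReal_mul, hself] at hle
  have hx' : 0 < ‖x‖ := norm_pos_iff.2 hx
  refine le_of_mul_le_mul_left ?_ hx'
  nlinarith

end Sqrt

/-- The adjoint of an invertible operator is bounded below. -/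
theorem norm_le_norm_symm_mul_norm_adjoint {E : Type u} {F : Type v}
    [NormedAddCommGroup E] [InnerProductSpace ℂ E] [CompleteSpace E]
    [NormedAddCommGroup F] [InnerProductSpace ℂ F] [CompleteSpace F] (L : E ≃L[ℂ] F) (y : F) :
    ‖y‖ ≤ ‖(L.symm : F →L[ℂ] E)‖ * ‖adjoint (L : E →L[ℂ] F) y‖ := by
  have h : adjoint (L.symm : F →L[ℂ] E) (adjoint (L : E →L[ℂ] F) y) = y := by
    rw [← comp_apply, ← adjoint_comp, ContinuousLinearEquiv.coe_comp_coe_symm, ← one_def,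
      ← star_eq_adjoint, star_one, one_def, id_apply]
  calc ‖y‖ = ‖adjoint (L.symm : F →L[ℂ] E) (adjoint (L : E →L[ℂ] F) y)‖ := by rw [h]
    _ ≤ ‖adjoint (L.symm : F →L[ℂ] E)‖ * ‖adjoint (L : E →L[ℂ] F) y‖ := le_opNorm _ _
    _ = _ := by rw [LinearIsometryEquiv.norm_map]

/-- If `X₁` is twice a projection, and `√X₂` is bounded below on its range, then `√X₂ - √X₁` is
Hilbert–Schmidt as soon as `X₂ - X₁` is. -/
theorem isHilbertSchmidt_opSqrt_sub_opSqrt {H : Type u} [NormedAddCommGroup H]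
    [InnerProductSpace ℂ H] [CompleteSpace H] {X₁ X₂ : H →L[ℂ] H} (h₁ : X₁.IsPositive)
    (h₂ : X₂.IsPositive) (hsq : X₁ * X₁ = (2 : ℂ) • X₁) {c : ℝ}
    (hgap : ∀ x, ‖opSqrt X₂ x‖ ≤ c * ‖X₂ x‖) (hD : IsHilbertSchmidt (X₂ - X₁)) :
    IsHilbertSchmidt (opSqrt X₂ - opSqrt X₁) := by
  obtain ⟨ι, b, hb⟩ := hD
  have hX₁X₁ (x : H) : X₁ (X₁ x) = (2 : ℂ) • X₁ x := by
    simpa using DFunLike.congr_fun hsq x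
  have hroot : (0 : ℝ) < √2 := by positivity
  have hroot_sq : ((√2 : ℝ) : ℂ) * ((√2 : ℝ) : ℂ) = 2 := by
    rw [← Complex.ofReal_mul, Real.mul_self_sqrt zero_le_two, Complex.ofReal_ofNat]
  have hB : opSqrt X₁ = (((√2)⁻¹ : ℝ) : ℂ) • X₁ := by
    refine opSqrt_eq_of_mul_self h₁ (h₁.smul_of_nonneg ?_) ?_
    · exact_mod_cast (inv_pos.2 hroot).le
    · rw [smul_mul_smul_comm, hsq, smul_smul, Complex.ofReal_inv, ← hroot_sq]
      field_simp
      simp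
  have hAA (x : H) : opSqrt X₂ (opSqrt X₂ x) = X₂ x := by
    simpa using DFunLike.congr_fun (opSqrt_mul_self h₂) x
  have hrange (x : H) : ‖(opSqrt X₂ - opSqrt X₁) (X₁ x)‖ ≤ (√2)⁻¹ * ‖((X₂ - X₁) * X₁) x‖ := by
    rw [inv_mul_eq_div, le_div_iff₀' hroot]
    refine ((isPositive_opSqrt h₂).mul_norm_le_norm_add_smul _).trans_eq ?_
    congr 1
    simp only [hB, mul_def, comp_apply, sub_apply, smul_apply, map_sub, map_smul, hAA, hX₁X₁,
      Complex.ofReal_inv, smul_sub, smul_smul]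
    have h2 : ((√2 : ℝ) : ℂ)⁻¹ * 2 = (√2 : ℝ) := by
      rw [← hroot_sq]; field_simp
    rw [h2, hroot_sq]
    abel
  have hker (x : H) : ‖(opSqrt X₂ - opSqrt X₁) ((2 : ℂ) • x - X₁ x)‖ ≤
      c * ‖((X₂ - X₁) * ((2 : ℂ) • 1 - X₁)) x‖ := by
    have hX₁ker : X₁ ((2 : ℂ) • x - X₁ x) = 0 := by
      rw [map_sub, map_smul, hX₁X₁, sub_self]
    have hy := hgap ((2 : ℂ) • x - X₁ x)
    simpa [hB, hX₁ker, -map_sub, -map_smul] using hy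
  refine ⟨ι, b, ?_⟩
  have hs₁ := summable_norm_sq_mul_right b hb X₁
  have hs₂ := summable_norm_sq_mul_right b hb ((2 : ℂ) • 1 - X₁)
  refine Summable.of_nonneg_of_le (fun _ => sq_nonneg _) (fun i => ?_)
    ((hs₁.mul_left ((√2)⁻¹ ^ 2)).add (hs₂.mul_left (c ^ 2)))
  set T := opSqrt X₂ - opSqrt X₁
  have hsplit : (2 : ℂ) • T (b i) = T (X₁ (b i)) + T ((2 : ℂ) • b i - X₁ (b i)) := by
    rw [← map_add, ← map_smul]
    congr 1
    abel
  have hnorm := norm_add_le (T (X₁ (b i))) (T ((2 : ℂ) • b i - X₁ (b i)))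
  rw [← hsplit, norm_smul, Complex.norm_ofNat] at hnorm
  rw [← mul_pow, ← mul_pow]
  have hle := hnorm.trans (add_le_add (hrange (b i)) (hker (b i)))
  have hnn := norm_nonneg (T (b i))
  nlinarith [sq_nonneg ((√2)⁻¹ * ‖((X₂ - X₁) * X₁) (b i)‖ -
    c * ‖((X₂ - X₁) * ((2 : ℂ) • 1 - X₁)) (b i)‖)]

end ContinuousLinearMap

open ContinuousLinearMap in
/-- For pure Gaussian one-particle data (`R₁² = R₂² = -1`), if `X₂ - X₁ = Q - 1` is
Hilbert–Schmidt then `√X₂ - √X₁` is Hilbert–Schmidt; moreover `X₁` and `X₂` are positive. -/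
theorem pure_sqrt_hilbertSchmidt_of_hilbertSchmidt
    {K₁ : Type u} {K₂ : Type v}
    [NormedAddCommGroup K₁] [InnerProductSpace ℂ K₁] [CompleteSpace K₁]
    [NormedAddCommGroup K₂] [InnerProductSpace ℂ K₂] [CompleteSpace K₂]
    (R₁ : K₁ →L[ℂ] K₁) (hR₁adj : ContinuousLinearMap.adjoint R₁ = -R₁) (hR₁sq : R₁ * R₁ = -1)
    (R₂ : K₂ →L[ℂ] K₂) (hR₂adj : ContinuousLinearMap.adjoint R₂ = -R₂) (hR₂sq : R₂ * R₂ = -1)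
    (L : K₁ ≃L[ℂ] K₂)
    (hL : ContinuousLinearMap.adjoint (L : K₁ →L[ℂ] K₂) ∘L R₂ ∘L (L : K₁ →L[ℂ] K₂) = R₁)
    (Q X₁ X₂ : K₁ →L[ℂ] K₁)
    (hQ : Q = ContinuousLinearMap.adjoint (L : K₁ →L[ℂ] K₂) ∘L (L : K₁ →L[ℂ] K₂))
    (hX₁ : X₁ = 1 - Complex.I • R₁) (hX₂ : X₂ = Q - Complex.I • R₁) :
    X₁.IsPositive ∧ X₂.IsPositive ∧
      (IsHilbertSchmidt (X₂ - X₁) → IsHilbertSchmidt (opSqrt X₂ - opSqrt X₁)) := by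
  have hX₂' : X₂ = adjoint (L : K₁ →L[ℂ] K₂) ∘L (1 - Complex.I • R₂) ∘L (L : K₁ →L[ℂ] K₂) := by
    rw [hX₂, hQ, ← hL]
    ext x
    simp
  have h₁ : X₁.IsPositive := hX₁ ▸ isPositive_one_sub_I_smul hR₁adj hR₁sq
  have h₂ : X₂.IsPositive := hX₂' ▸ (isPositive_one_sub_I_smul hR₂adj hR₂sq).adjoint_conj _
  refine ⟨h₁, h₂, isHilbertSchmidt_opSqrt_sub_opSqrt h₁ h₂ (hX₁ ▸ one_sub_I_smul_mul_self hR₁sq)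
    (c := ‖(L.symm : K₂ →L[ℂ] K₁)‖) fun x => ?_⟩
  have hform : 2 * ‖opSqrt X₂ x‖ ^ 2 = ‖(1 - Complex.I • R₂) (L x)‖ ^ 2 := by
    have h : (2 : ℂ) * (‖opSqrt X₂ x‖ : ℂ) ^ 2 = (‖(1 - Complex.I • R₂) (L x)‖ : ℂ) ^ 2 := by
      rw [norm_opSqrt_apply_sq h₂, ← inner_one_sub_I_smul hR₂adj hR₂sq, hX₂', comp_apply,
        adjoint_inner_right]
      rfl
    exact_mod_cast h
  have hbelow := norm_le_norm_symm_mul_norm_adjoint L ((1 - Complex.I • R₂) (L x))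
  have hX₂x : adjoint (L : K₁ →L[ℂ] K₂) ((1 - Complex.I • R₂) (L x)) = X₂ x := by
    rw [hX₂']
    rfl
  rw [hX₂x] at hbelow
  refine le_trans ((sq_le_sq₀ (norm_nonneg _) (norm_nonneg _)).1 ?_) hbelow
  nlinarith [sq_nonneg ‖opSqrt X₂ x‖]
end
end

section
/- Let H be a complex Hilbert space, let O be a positive bounded operator on H, and let M be a bounded operator on H such that M − 1 is Hilbert–Schmidt. Then √(M† ∘ O ∘ M) − √O is Hilbert–Schmidt. -/
noncomputable section

universe u v w

open Filter Topology

theorem CStarAlgebra.cfc_sqrt_mul_self {A : Type*} [CStarAlgebra A] [PartialOrder A]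
    [StarOrderedRing A] {a : A} (ha : 0 ≤ a) : cfc Real.sqrt a * cfc Real.sqrt a = a := by
  rw [← cfc_mul _ _ _ (by fun_prop) (by fun_prop)]
  conv_rhs => rw [← cfc_id' ℝ a]
  exact cfc_congr fun t ht => Real.mul_self_sqrt (spectrum_nonneg_of_nonneg ha ht)

/-- Heuristically `x + star x ≤ |x| + |star x|`, where `|star x|` is replaced by
`x * (|x| + ε)⁻¹ * star x`. -/
theorem CStarAlgebra.exists_add_star_le {A : Type*} [CStarAlgebra A] [PartialOrder A]
    [StarOrderedRing A] (x : A) {ε : ℝ} (hε : 0 < ε) :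
    ∃ c : A, IsSelfAdjoint c ∧ c * c ≤ x * star x ∧
      x + star x ≤ cfc Real.sqrt (star x * x) + algebraMap ℝ A ε + c := by
  set g := star x * x with hg
  have hgs : IsSelfAdjoint g := .star_mul_self x
  have hpos (t : ℝ) : 0 < √t + ε := by positivity
  have hne (t : ℝ) : √t + ε ≠ 0 := (hpos t).ne'
  have hne' (t : ℝ) : √(√t + ε) ≠ 0 := (Real.sqrt_pos.2 (hpos t)).ne'
  set u := cfc (fun t : ℝ => √(√t + ε)) g
  set v := cfc (fun t : ℝ => (√(√t + ε))⁻¹) g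
  set w := cfc (fun t : ℝ => (√t + ε)⁻¹) g
  have hcu : Continuous fun t : ℝ => √(√t + ε) := by fun_prop
  have hcv : Continuous fun t : ℝ => (√(√t + ε))⁻¹ := hcu.inv₀ hne'
  have hcw : Continuous fun t : ℝ => (√t + ε)⁻¹ :=
    Continuous.inv₀ (by fun_prop) hne
  have huu : u * u = cfc Real.sqrt g + algebraMap ℝ A ε := by
    rw [← cfc_mul _ _ g hcu.continuousOn hcu.continuousOn, ← cfc_const ε g, ← cfc_add ..]
    exact cfc_congr fun t _ => Real.mul_self_sqrt (hpos t).le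
  have hvv : v * v = w := by
    rw [← cfc_mul _ _ g hcv.continuousOn hcv.continuousOn]
    refine cfc_congr fun t _ => ?_
    rw [← mul_inv, Real.mul_self_sqrt (hpos t).le]
  have huv : u * v = 1 := by
    rw [← cfc_mul _ _ g hcu.continuousOn hcv.continuousOn, ← cfc_one ℝ g]
    exact cfc_congr fun t _ => mul_inv_cancel₀ (hne' t)
  have hvu : v * u = 1 := (cfc_commute_cfc _ _ g).eq.trans huv
  have hus : star u = u := (cfc_predicate _ g : IsSelfAdjoint u)
  have hvs : star v = v := (cfc_predicate _ g : IsSelfAdjoint v)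
  have hws : star w = w := (cfc_predicate _ g : IsSelfAdjoint w)
  have hwgw : w * g * w ≤ 1 := by
    have : w * g * w = cfc (fun t : ℝ => (√t + ε)⁻¹ * t * (√t + ε)⁻¹) g := by
      rw [cfc_mul (fun t : ℝ => (√t + ε)⁻¹ * t) _ g (hcw.mul continuous_id).continuousOn
        hcw.continuousOn, cfc_mul _ (fun t => t) g hcw.continuousOn continuousOn_id, cfc_id' ℝ g]
    rw [this]
    refine cfc_le_one _ _ fun t ht => ?_
    have ht0 : 0 ≤ t := spectrum_nonneg_of_nonneg (star_mul_self_nonneg x) ht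
    rw [mul_comm, ← mul_assoc, ← mul_inv, inv_mul_le_iff₀ (by have := hpos t; positivity), mul_one]
    nlinarith [Real.mul_self_sqrt ht0, Real.sqrt_nonneg t]
  refine ⟨x * w * star x, ?_, ?_, ?_⟩
  · simp [IsSelfAdjoint, hws, mul_assoc]
  · have h := star_right_conjugate_le_conjugate hwgw x
    calc x * w * star x * (x * w * star x) = x * (w * g * w) * star x := by
          simp only [hg, mul_assoc]
      _ ≤ x * 1 * star x := h
      _ = x * star x := by rw [mul_one]
  · rw [← sub_nonneg]
    have h := star_mul_self_nonneg (u - v * star x)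
    have e : star (u - v * star x) * (u - v * star x) =
        u * u - x * (v * u) - (u * v) * star x + x * (v * v) * star x := by
      simp only [star_sub, star_mul, star_star, hus, hvs]
      noncomm_ring
    rw [e, huu, hvv, huv, hvu] at h
    convert h using 1
    noncomm_ring

/-- For a positive functional `τ` that is tracial on the commutant of `p`, the absolute value
satisfies `‖|x| - y‖₂ ^ 2 ≤ 2 * ‖x - y‖₂ ^ 2` in the seminorm of `τ` when `y` is positive and
`x`, `y` commute with `p`. -/
theorem CStarAlgebra.trace_abs_sub_sq_le {A : Type*} [CStarAlgebra A] [PartialOrder A]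
    [StarOrderedRing A] (τ : A →ₗ[ℝ] ℝ) (p : A) (hpos : ∀ a, 0 ≤ a → 0 ≤ τ a)
    (hstar : ∀ a, τ (star a) = τ a) (htr : ∀ a b, Commute a p → τ (a * b) = τ (b * a))
    {x y : A} (hy : 0 ≤ y) (hxp : Commute x p) (hyp : Commute y p) :
    τ (star (cfc Real.sqrt (star x * x) - y) * (cfc Real.sqrt (star x * x) - y)) ≤
      2 * τ (star (x - y) * (x - y)) := by
  set a := cfc Real.sqrt (star x * x)
  have hys : star y = y := (IsSelfAdjoint.of_nonneg hy).star_eq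
  have has : star a = a := (cfc_predicate _ _ : IsSelfAdjoint a)
  have haa : a * a = star x * x := cfc_sqrt_mul_self (star_mul_self_nonneg x)
  have hmono {a b : A} (h : a ≤ b) : τ a ≤ τ b := by
    have := hpos _ (sub_nonneg.2 h)
    rwa [map_sub, sub_nonneg] at this
  have hmul {n : A} (hn : 0 ≤ n) : 0 ≤ τ (n * y) := by
    set r := cfc Real.sqrt y
    have hrs : star r = r := (cfc_predicate _ _ : IsSelfAdjoint r)
    have hrr : r * r = y := cfc_sqrt_mul_self hy
    have := hpos _ (star_left_conjugate_nonneg hn r)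
    rw [hrs, mul_assoc, htr r _ (hyp.cfc_real _), mul_assoc, hrr] at this
    exact this
  have hxy : τ (star x * y) = τ (x * y) := by
    rw [← hstar, star_mul, star_star, hys, htr y _ hyp]
  have key : 4 * τ (x * y) ≤ 2 * τ (a * y) + τ (star x * x) + τ (y * y) := by
    refine le_of_forall_pos_le_add fun δ hδ => ?_
    set ε := δ / (2 * (|τ y| + 1)) with hεd
    have hε : 0 < ε := by positivity
    obtain ⟨c, hcs, hcc, hle⟩ := exists_add_star_le x hε
    have h1 := hmul (sub_nonneg.2 hle)
    have h2 := hpos _ (star_mul_self_nonneg (c - y))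
    have h3 := hmono hcc
    rw [htr x _ hxp] at h3
    have e1 : τ ((a + algebraMap ℝ A ε + c - (x + star x)) * y) =
        τ (a * y) + ε * τ y + τ (c * y) - τ (x * y) - τ (star x * y) := by
      simp only [sub_mul, add_mul, map_sub, map_add, ← Algebra.smul_def, map_smul, smul_eq_mul]
      ring
    have e2 : τ (star (c - y) * (c - y)) = τ (c * c) + τ (y * y) - 2 * τ (c * y) := by
      simp only [star_sub, hys, hcs.star_eq, sub_mul, mul_sub, map_sub, htr y c hyp]
      ring
    have h4 : 2 * (ε * τ y) ≤ δ := by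
      have : ε * (2 * (|τ y| + 1)) = δ := by rw [hεd]; field_simp
      nlinarith [le_abs_self (τ y)]
    rw [e1, hxy] at h1
    rw [e2] at h2
    linarith
  simp only [star_sub, hys, has, sub_mul, mul_sub, map_sub, haa, htr y _ hyp, hxy]
  linarith

section
variable {H : Type*} [NormedAddCommGroup H] [InnerProductSpace ℂ H]

theorem ContinuousLinearMap.tendsto_mul_apply {α : Type*} {l : Filter α} {S T : α → H →L[ℂ] H}
    {S₀ T₀ : H →L[ℂ] H} {R : ℝ} (hR : ∀ i, ‖S i‖ ≤ R)
    (hS : ∀ x, Tendsto (fun i => S i x) l (𝓝 (S₀ x)))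
    (hT : ∀ x, Tendsto (fun i => T i x) l (𝓝 (T₀ x))) (x : H) :
    Tendsto (fun i => (S i * T i) x) l (𝓝 ((S₀ * T₀) x)) := by
  have h : Tendsto (fun i => S i (T i x - T₀ x)) l (𝓝 0) := by
    refine squeeze_zero_norm (fun i => (S i).le_of_opNorm_le (hR i) _) ?_
    simpa using ((tendsto_sub_nhds_zero_iff.2 (hT x)).norm).const_mul R
  simpa using h.add (hS (T₀ x))

/-- The continuous functional calculus is strongly continuous on bounded sets of self-adjoint
operators. -/
theorem ContinuousLinearMap.tendsto_cfc_apply [CompleteSpace H] {α : Type*} {l : Filter α} {S : α → H →L[ℂ] H}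
    {S₀ : H →L[ℂ] H} {R : ℝ} (hR : ∀ i, ‖S i‖ ≤ R) (hR₀ : ‖S₀‖ ≤ R)
    (hsa : ∀ i, IsSelfAdjoint (S i)) (hsa₀ : IsSelfAdjoint S₀)
    (hS : ∀ x, Tendsto (fun i => S i x) l (𝓝 (S₀ x))) {f : ℝ → ℝ} (hf : Continuous f) (x : H) :
    Tendsto (fun i => cfc f (S i) x) l (𝓝 (cfc f S₀ x)) := by
  have hpoly (q : Polynomial ℝ) :
      ∀ x, Tendsto (fun i => Polynomial.aeval (S i) q x) l (𝓝 (Polynomial.aeval S₀ q x)) := by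
    induction q using Polynomial.induction_on with
    | C a => intro x; simpa using tendsto_const_nhds
    | add p q hp hq => intro x; simpa using (hp x).add (hq x)
    | monomial n a h =>
      intro x
      simp only [pow_succ', ← mul_assoc, mul_comm _ Polynomial.X] at h ⊢
      simp only [mul_assoc, map_mul _ Polynomial.X, Polynomial.aeval_X] at h ⊢
      exact tendsto_mul_apply hR hS h x
  have hnear (q : Polynomial ℝ) {δ : ℝ} (hδ : 0 ≤ δ)
      (hq : ∀ t ∈ Set.Icc (-R) R, |q.eval t - f t| < δ) {T : H →L[ℂ] H} (hT : IsSelfAdjoint T)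
      (hTR : ‖T‖ ≤ R) : ‖Polynomial.aeval T q x - cfc f T x‖ ≤ δ * ‖x‖ := by
    nontriviality H
    rw [← sub_apply, ← cfc_polynomial q T, ← cfc_sub ..]
    refine le_of_opNorm_le _ (norm_cfc_le hδ fun t ht => (hq t ?_).le) x
    exact abs_le.1 ((spectrum.norm_le_norm_of_mem ht).trans hTR)
  rw [Metric.tendsto_nhds]
  intro ε hε
  set δ := ε / (3 * (‖x‖ + 1)) with hδd
  have hδ : 0 < δ := by positivity
  have hδx : δ * ‖x‖ < ε / 3 := by
    have : δ * (‖x‖ + 1) = ε / 3 := by rw [hδd]; field_simp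
    linarith
  obtain ⟨q, hq⟩ := exists_polynomial_near_of_continuousOn (-R) R f hf.continuousOn δ hδ
  filter_upwards [Metric.tendsto_nhds.1 (hpoly q x) (ε / 3) (by positivity)] with i hi
  have h1 := hnear q hδ.le hq (hsa i) (hR i)
  have h2 := hnear q hδ.le hq hsa₀ hR₀
  rw [← dist_eq_norm] at h1 h2
  rw [dist_comm] at h1
  linarith [dist_triangle4 (cfc f (S i) x) (Polynomial.aeval (S i) q x)
    (Polynomial.aeval S₀ q x) (cfc f S₀ x)]

namespace HilbertBasis
variable {ι : Type*} (b : HilbertBasis ι ℂ H)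

/-- The orthogonal projection onto the span of finitely many vectors of a Hilbert basis. -/
def partialProj (s : Finset ι) : H →L[ℂ] H :=
  ∑ i ∈ s, InnerProductSpace.rankOne ℂ (b i) (b i)

/-- The real part of the trace of the compression of an operator to the span of finitely many
vectors of a Hilbert basis. -/
def partialTrace (s : Finset ι) : (H →L[ℂ] H) →ₗ[ℝ] ℝ where
  toFun T := ∑ i ∈ s, (inner ℂ (b i) (T (b i))).re
  map_add' S T := by simp [Finset.sum_add_distrib]
  map_smul' r T := by simp [Finset.mul_sum]

theorem partialProj_apply (s : Finset ι) (x : H) :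
    b.partialProj s x = ∑ i ∈ s, inner ℂ (b i) x • b i := by
  simp [partialProj]

theorem partialProj_apply_self {s : Finset ι} {i : ι} (hi : i ∈ s) :
    b.partialProj s (b i) = b i := by
  classical
  rw [partialProj_apply, Finset.sum_eq_single_of_mem i hi]
  · simp [b.orthonormal.1 i]
  · intro j _ hj
    rw [b.orthonormal.2 hj, zero_smul]

theorem isStarProjection_partialProj [CompleteSpace H] (s : Finset ι) : IsStarProjection (b.partialProj s) where
  isIdempotentElem := by
    ext x
    rw [mul_apply_eq_comp, partialProj_apply b s x, map_sum]
    refine Finset.sum_congr rfl fun i hi => ?_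
    rw [map_smul, b.partialProj_apply_self hi]
  isSelfAdjoint := by
    simp [IsSelfAdjoint, partialProj, ContinuousLinearMap.star_eq_adjoint]

theorem norm_partialProj_le [CompleteSpace H] (s : Finset ι) : ‖b.partialProj s‖ ≤ 1 :=
  (b.isStarProjection_partialProj s).norm_le

theorem tendsto_partialProj (x : H) :
    Tendsto (fun s => b.partialProj s x) atTop (𝓝 x) := by
  simp only [partialProj_apply, ← b.repr_apply_apply]
  exact b.hasSum_repr x

theorem partialTrace_star_mul_self [CompleteSpace H] (s : Finset ι) (T : H →L[ℂ] H) :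
    b.partialTrace s (star T * T) = ∑ i ∈ s, ‖T (b i)‖ ^ 2 := by
  refine Finset.sum_congr rfl fun i _ => ?_
  rw [mul_apply_eq_comp, ContinuousLinearMap.star_eq_adjoint,
    ContinuousLinearMap.adjoint_inner_right, inner_self_eq_norm_sq_to_K]
  norm_cast

theorem partialTrace_nonneg (s : Finset ι) {T : H →L[ℂ] H} (hT : 0 ≤ T) :
    0 ≤ b.partialTrace s T :=
  Finset.sum_nonneg fun i _ =>
    ((ContinuousLinearMap.nonneg_iff_isPositive T).1 hT).re_inner_nonneg_right (b i)

theorem partialTrace_star [CompleteSpace H] (s : Finset ι) (T : H →L[ℂ] H) :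
    b.partialTrace s (star T) = b.partialTrace s T := by
  refine Finset.sum_congr rfl fun i _ => ?_
  rw [ContinuousLinearMap.star_eq_adjoint, ContinuousLinearMap.adjoint_inner_right,
    ← inner_conj_symm, Complex.conj_re]

theorem inner_mul_partialProj_mul (s : Finset ι) (S T : H →L[ℂ] H) (x y : H) :
    inner ℂ x ((S * b.partialProj s * T) y) =
      ∑ j ∈ s, inner ℂ (b j) (T y) * inner ℂ x (S (b j)) := by
  simp [partialProj_apply]

theorem partialTrace_mul_comm [CompleteSpace H] (s : Finset ι) {S : H →L[ℂ] H} (T : H →L[ℂ] H)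
    (hS : Commute S (b.partialProj s)) :
    b.partialTrace s (S * T) = b.partialTrace s (T * S) := by
  have h1 (i : ι) (hi : i ∈ s) : inner ℂ (b i) ((S * T) (b i)) =
      inner ℂ (b i) ((S * b.partialProj s * T) (b i)) := by
    have hP := (b.isStarProjection_partialProj s).isSelfAdjoint.isSymmetric
    calc inner ℂ (b i) ((S * T) (b i))
        = inner ℂ (b.partialProj s (b i)) ((S * T) (b i)) := by rw [b.partialProj_apply_self hi]
      _ = inner ℂ (b i) ((b.partialProj s * (S * T)) (b i)) := hP _ _
      _ = inner ℂ (b i) ((S * b.partialProj s * T) (b i)) := by rw [hS.eq, mul_assoc]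
  have h2 (i : ι) (hi : i ∈ s) : inner ℂ (b i) ((T * S) (b i)) =
      inner ℂ (b i) ((T * b.partialProj s * S) (b i)) := by
    rw [mul_assoc, ← hS.eq, ← mul_assoc, mul_apply_eq_comp _ (b.partialProj s),
      b.partialProj_apply_self hi]
  simp only [partialTrace, LinearMap.coe_mk, AddHom.coe_mk, ← Complex.re_sum]
  rw [Finset.sum_congr rfl h1, Finset.sum_congr rfl h2]
  simp only [inner_mul_partialProj_mul]
  rw [Finset.sum_comm]
  simp only [mul_comm]

end HilbertBasis
theorem HilbertBasis.sum_norm_abs_sub_sq_le [CompleteSpace H] {ι : Type*}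
    (b : HilbertBasis ι ℂ H) {X Y : H →L[ℂ] H} (hY : 0 ≤ Y)
    (h : Summable fun i => ‖(X - Y) (b i)‖ ^ 2) (t : Finset ι) :
    ∑ i ∈ t, ‖(cfc Real.sqrt (star X * X) - Y) (b i)‖ ^ 2 ≤ 2 * ∑' i, ‖(X - Y) (b i)‖ ^ 2 := by
  set P := b.partialProj
  have hPs (s) : star (P s) = P s := (b.isStarProjection_partialProj s).isSelfAdjoint
  have hPP (s) : P s * P s = P s := (b.isStarProjection_partialProj s).isIdempotentElem
  have hP1 (s) : ‖P s‖ ≤ 1 := b.norm_partialProj_le s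
  have hcomm (T : H →L[ℂ] H) (s) : Commute (P s * T * P s) (P s) := by
    rw [Commute, SemiconjBy, mul_assoc, hPP, mul_assoc, ← mul_assoc (P s) (P s), hPP]
  have hnorm (T : H →L[ℂ] H) (s) : ‖P s * T * P s‖ ≤ ‖T‖ :=
    calc ‖P s * T * P s‖ ≤ ‖P s‖ * ‖T‖ * ‖P s‖ := norm_mul₃_le
      _ ≤ 1 * ‖T‖ * 1 := by gcongr <;> exact hP1 s
      _ = ‖T‖ := by ring
  have hlim (T : H →L[ℂ] H) (x : H) :
      Tendsto (fun s => (P s * T * P s) x) atTop (𝓝 (T x)) := by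
    have h1 := ContinuousLinearMap.tendsto_mul_apply (T := fun _ => T) hP1
      (S₀ := 1) b.tendsto_partialProj (fun x => tendsto_const_nhds)
    have h2 := ContinuousLinearMap.tendsto_mul_apply (T₀ := 1) (R := ‖T‖)
      (fun s => (norm_mul_le _ _).trans (mul_le_of_le_one_left (norm_nonneg T) (hP1 s)))
      h1 b.tendsto_partialProj x
    simpa using h2
  set Z := fun s => P s * X * P s
  have hZstar (s) : star (Z s) = P s * star X * P s := by simp [Z, hPs, mul_assoc]
  have hbound (s) : ∑ i ∈ s, ‖(cfc Real.sqrt (star (Z s) * Z s) - P s * Y * P s) (b i)‖ ^ 2 ≤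
      2 * ∑' i, ‖(X - Y) (b i)‖ ^ 2 := by
    have hYs : 0 ≤ P s * Y * P s := by simpa [hPs] using star_left_conjugate_nonneg hY (P s)
    have key := CStarAlgebra.trace_abs_sub_sq_le (b.partialTrace s) (P s)
      (fun _ => b.partialTrace_nonneg s) (b.partialTrace_star s)
      (fun _ T => b.partialTrace_mul_comm s T) hYs (hcomm X s) (hcomm Y s)
    rw [b.partialTrace_star_mul_self, b.partialTrace_star_mul_self] at key
    refine key.trans (mul_le_mul_of_nonneg_left ?_ zero_le_two)
    refine le_trans (Finset.sum_le_sum fun i hi => ?_) (h.sum_le_tsum s fun i _ => by positivity)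
    have e : (P s * X * P s - P s * Y * P s) (b i) = P s ((X - Y) (b i)) := by
      simp [P, b.partialProj_apply_self hi]
    rw [e]
    gcongr
    simpa using (P s).le_of_opNorm_le (hP1 s) ((X - Y) (b i))
  have hZZ (x : H) : Tendsto (fun s => (star (Z s) * Z s) x) atTop (𝓝 ((star X * X) x)) := by
    refine ContinuousLinearMap.tendsto_mul_apply (R := ‖X‖) (fun s => ?_) (fun x => ?_) (hlim X) x
    · rw [norm_star]
      exact hnorm X s
    · simp only [hZstar]
      exact hlim (star X) x
  have habs := ContinuousLinearMap.tendsto_cfc_apply (R := ‖X‖ * ‖X‖)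
    (fun s => by
      rw [CStarRing.norm_star_mul_self]
      exact mul_self_le_mul_self (norm_nonneg _) (hnorm X s))
    CStarRing.norm_star_mul_self.le (fun s => .star_mul_self (Z s)) (.star_mul_self X) hZZ
    Real.continuous_sqrt
  refine le_of_tendsto (tendsto_finsetSum t fun i _ =>
    (((habs (b i)).sub (hlim Y (b i))).norm.pow 2)) ?_
  filter_upwards [eventually_ge_atTop t] with s hs
  exact (Finset.sum_le_sum_of_subset_of_nonneg hs fun i _ _ => by positivity).trans (hbound s)

end

/-- If `O` is positive and `M - 1` is Hilbert–Schmidt, then `√(M† O M) - √O` is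
Hilbert–Schmidt. -/
theorem sqrt_conjugation_hilbertSchmidt
    {H : Type u} [NormedAddCommGroup H] [InnerProductSpace ℂ H] [CompleteSpace H]
    (O M : H →L[ℂ] H) (hO : O.IsPositive)
    (hM : IsHilbertSchmidt (M - 1)) :
    IsHilbertSchmidt (opSqrt (ContinuousLinearMap.adjoint M * O * M) - opSqrt O) := by
  obtain ⟨ι, b, hb⟩ := hM
  have hO' : 0 ≤ O := (ContinuousLinearMap.nonneg_iff_isPositive O).2 hO
  set Y := opSqrt O
  have hY0 : 0 ≤ Y := cfc_nonneg fun _ _ => Real.sqrt_nonneg _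
  have hYs : star Y = Y := (IsSelfAdjoint.of_nonneg hY0).star_eq
  have hYY : Y * Y = O := CStarAlgebra.cfc_sqrt_mul_self hO'
  have hX : ContinuousLinearMap.adjoint M * O * M = star (Y * M) * (Y * M) := by
    rw [star_mul, hYs, ← ContinuousLinearMap.star_eq_adjoint, ← hYY]
    simp only [mul_assoc]
  have hsum : Summable fun i => ‖(Y * M - Y) (b i)‖ ^ 2 := by
    refine (hb.mul_left (‖Y‖ ^ 2)).of_nonneg_of_le (fun i => by positivity) fun i => ?_
    rw [← mul_pow]
    have e : (Y * M - Y) (b i) = Y ((M - 1) (b i)) := by simp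
    rw [e]
    gcongr
    exact Y.le_opNorm _
  refine ⟨ι, b, summable_of_sum_le (fun i => by positivity) (c := 2 * ∑' i, ‖(Y * M - Y) (b i)‖ ^ 2)
    fun t => ?_⟩
  rw [hX]
  exact b.sum_norm_abs_sub_sq_le hY0 hsum t
end
end

section
/- Let K₁ and K₂ be complex Hilbert spaces and L : K₁ → K₂ a bounded bijective linear map. Let R₁ be a bounded operator on K₁ with R₁† = −R₁ and ‖R₁‖ ≤ 1. Define R₂ := (L⁻¹)† ∘ R₁ ∘ L⁻¹ on K₂ (so R₂† = −R₂ and L† ∘ R₂ ∘ L = R₁) and assume ‖R₂‖ ≤ 1. Set Q := L† ∘ L on K₁ and Q' := (L⁻¹)† ∘ L⁻¹ on K₂. Then Q − i·R₁ and 1 − i·R₁ are positive on K₁, Q' − i·R₂ and 1 − i·R₂ are positive on K₂, and: if √(Q − i·R₁) − √(1 − i·R₁) is Hilbert–Schmidt, then √(Q' − i·R₂) − √(1 − i·R₂) is Hilbert–Schmidt. -/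
noncomputable section

universe u v w

open scoped InnerProductSpace InnerProduct Topology
open Filter

section FiniteDimensional

variable {V W : Type*} [NormedAddCommGroup V] [InnerProductSpace ℂ V]
  [NormedAddCommGroup W] [InnerProductSpace ℂ W]

lemma OrthonormalBasis.sum_norm_sq_apply_eq_trace {ι : Type*} [Fintype ι]
    [FiniteDimensional ℂ V] [CompleteSpace V] [CompleteSpace W]
    (b : OrthonormalBasis ι ℂ V) (A : V →L[ℂ] W) :
    ((∑ i, ‖A (b i)‖ ^ 2 : ℝ) : ℂ) =
      LinearMap.trace ℂ V ((A† ∘L A : V →L[ℂ] V) : V →ₗ[ℂ] V) := by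
  rw [LinearMap.trace_eq_sum_inner _ b]
  push_cast
  refine Finset.sum_congr rfl fun i _ => ?_
  simp [ContinuousLinearMap.adjoint_inner_right, inner_self_eq_norm_sq_to_K]

/-- Two orthonormal bases of a finite-dimensional space give the same Hilbert–Schmidt norm. -/
lemma OrthonormalBasis.sum_norm_sq_apply_eq {ι κ : Type*} [Fintype ι] [Fintype κ]
    [FiniteDimensional ℂ V] [CompleteSpace V] [CompleteSpace W]
    (b : OrthonormalBasis ι ℂ V) (c : OrthonormalBasis κ ℂ V)
    (A : V →L[ℂ] W) : ∑ i, ‖A (b i)‖ ^ 2 = ∑ k, ‖A (c k)‖ ^ 2 :=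
  Complex.ofReal_injective <|
    (b.sum_norm_sq_apply_eq_trace A).trans (c.sum_norm_sq_apply_eq_trace A).symm

/-- Bessel's inequality for the orthogonal family `T (u j)`, whose members have norm `x j`. -/
lemma sum_norm_inner_div_sq_le {κ : Type*} [Fintype κ] (g : κ → W) (x : κ → ℝ)
    (horth : ∀ j k, j ≠ k → ⟪g j, g k⟫_ℂ = 0) (hnorm : ∀ j, ‖g j‖ = x j) (w : W) :
    ∑ j, (‖⟪g j, w⟫_ℂ‖ / x j) ^ 2 ≤ ‖w‖ ^ 2 := by
  classical
  have hon : Orthonormal ℂ fun j : {j // x j ≠ 0} => ((x j : ℂ)⁻¹) • g j := by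
    refine ⟨fun j => ?_, fun j k hjk => ?_⟩
    · have h0 : 0 ≤ x j := hnorm j ▸ norm_nonneg _
      rw [norm_smul, norm_inv, Complex.norm_real, Real.norm_of_nonneg h0, hnorm,
        inv_mul_cancel₀ j.2]
    · simp [inner_smul_left, inner_smul_right, horth j k fun h => hjk (Subtype.ext h)]
  have hb := hon.sum_inner_products_le w (s := Finset.univ)
  calc ∑ j, (‖⟪g j, w⟫_ℂ‖ / x j) ^ 2
      = ∑ j with x j ≠ 0, (‖⟪g j, w⟫_ℂ‖ / x j) ^ 2 :=
        (Finset.sum_filter_of_ne fun j _ hj => mt (fun h0 => by simp [h0]) hj).symm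
    _ = ∑ j : {j // x j ≠ 0}, (‖⟪g j, w⟫_ℂ‖ / x j) ^ 2 :=
        Finset.sum_subtype _ (by simp) _
    _ = ∑ j : {j // x j ≠ 0}, ‖⟪((x j : ℂ)⁻¹) • g j, w⟫_ℂ‖ ^ 2 := by
        refine Finset.sum_congr rfl fun j _ => ?_
        rw [inner_smul_left, norm_mul, RCLike.norm_conj, norm_inv, Complex.norm_real,
          Real.norm_eq_abs, div_eq_inv_mul, mul_pow, mul_pow, inv_pow, inv_pow, sq_abs]
    _ ≤ ‖w‖ ^ 2 := hb

lemma sq_le_add_sq_of_mul_eq {x y s a b : ℝ} (hx : 0 ≤ x) (hy : 0 ≤ y) (hxy : 0 < x + y)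
    (hs : 0 ≤ s) (h : (x + y) * s ≤ x * a + y * b) : s ^ 2 ≤ a ^ 2 + b ^ 2 := by
  have h1 : ((x + y) * s) ^ 2 ≤ (x * a + y * b) ^ 2 :=
    pow_le_pow_left₀ (by positivity) h 2
  have h2 : (x * a + y * b) ^ 2 ≤ (x + y) ^ 2 * (a ^ 2 + b ^ 2) := by
    nlinarith [mul_nonneg hx hy, sq_nonneg (x * b - y * a),
      mul_nonneg (mul_nonneg hx hy) (add_nonneg (sq_nonneg a) (sq_nonneg b))]
  rw [mul_pow] at h1
  exact le_of_mul_le_mul_left (h1.trans h2) (by positivity)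

lemma ContinuousLinearMap.IsPositive.exists_eigenbasis [FiniteDimensional ℂ V] {X : V →L[ℂ] V}
    (hX : X.IsPositive) :
    ∃ (u : OrthonormalBasis (Fin (Module.finrank ℂ V)) ℂ V) (x : Fin (Module.finrank ℂ V) → ℝ),
      (∀ j, 0 ≤ x j) ∧ ∀ j, X (u j) = (x j : ℂ) • u j :=
  ⟨hX.isSymmetric.eigenvectorBasis rfl, hX.isSymmetric.eigenvalues rfl,
    fun j => hX.toLinearMap.nonneg_eigenvalues rfl j,
    fun j => hX.isSymmetric.apply_eigenvectorBasis rfl j⟩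

/-- The finite-dimensional Araki–Yamagami inequality. -/
theorem sum_norm_sq_sub_le_of_sq_eq {ι : Type*} [Fintype ι] [FiniteDimensional ℂ V]
    [CompleteSpace V] [CompleteSpace W] {T T' : V →L[ℂ] W} {X Y : V →L[ℂ] V}
    (hX : X.IsPositive) (hY : Y.IsPositive)
    (hXT : X ∘L X = T† ∘L T) (hYT : Y ∘L Y = T'† ∘L T') (b : OrthonormalBasis ι ℂ V) :
    ∑ i, ‖(X - Y) (b i)‖ ^ 2 ≤ 2 * ∑ i, ‖(T - T') (b i)‖ ^ 2 := by
  obtain ⟨u, x, hx, hu⟩ := hX.exists_eigenbasis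
  obtain ⟨v, y, hy, hv⟩ := hY.exists_eigenbasis
  set D := T - T' with hD
  have gram {S : V →L[ℂ] W} {Z : V →L[ℂ] V} (hZ : Z.IsPositive) (h : Z ∘L Z = S† ∘L S) (p q : V) :
      ⟪S p, S q⟫_ℂ = ⟪Z p, Z q⟫_ℂ := by
    rw [← ContinuousLinearMap.adjoint_inner_right, ← ContinuousLinearMap.comp_apply, ← h,
      ContinuousLinearMap.comp_apply, hZ.inner_left_eq_inner_right]
  have orth {S : V →L[ℂ] W} {Z : V →L[ℂ] V} (hZ : Z.IsPositive) (h : Z ∘L Z = S† ∘L S)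
      {c : OrthonormalBasis (Fin (Module.finrank ℂ V)) ℂ V} {z : Fin (Module.finrank ℂ V) → ℝ}
      (hc : ∀ j, Z (c j) = (z j : ℂ) • c j) (j k) (hjk : j ≠ k) : ⟪S (c j), S (c k)⟫_ℂ = 0 := by
    rw [gram hZ h, hc, hc]
    simp [c.inner_eq_zero hjk]
  have norm_eq {S : V →L[ℂ] W} {Z : V →L[ℂ] V} (hZ : Z.IsPositive) (h : Z ∘L Z = S† ∘L S)
      {c : OrthonormalBasis (Fin (Module.finrank ℂ V)) ℂ V} {z : Fin (Module.finrank ℂ V) → ℝ}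
      (hz : ∀ j, 0 ≤ z j)
      (hc : ∀ j, Z (c j) = (z j : ℂ) • c j) (j) : ‖S (c j)‖ = z j := by
    have h1 : ‖S (c j)‖ = ‖Z (c j)‖ := by
      rw [@norm_eq_sqrt_re_inner ℂ, @norm_eq_sqrt_re_inner ℂ, gram hZ h]
    rw [h1, hc, norm_smul, c.norm_eq_one, mul_one, Complex.norm_real, Real.norm_of_nonneg (hz j)]
  have hTn := norm_eq hX hXT hx hu
  have hTn' := norm_eq hY hYT hy hv
  have entry (j k) : ‖⟪u j, (X - Y) (v k)⟫_ℂ‖ ^ 2 ≤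
      (‖⟪T (u j), D (v k)⟫_ℂ‖ / x j) ^ 2 + (‖⟪T' (v k), D (u j)⟫_ℂ‖ / y k) ^ 2 := by
    have hs : ⟪u j, (X - Y) (v k)⟫_ℂ = ((x j - y k : ℝ) : ℂ) * ⟪u j, v k⟫_ℂ := by
      rw [sub_apply, inner_sub_right, ← hX.inner_left_eq_inner_right, hu, hv,
        inner_smul_left, inner_smul_right]
      simp [sub_mul]
    rcases (add_nonneg (hx j) (hy k)).eq_or_lt with h0 | h0
    · have hx0 : x j = 0 := by linarith [hx j, hy k]
      have hy0 : y k = 0 := by linarith [hx j, hy k]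
      rw [hs, hx0, hy0]
      simp
    · refine sq_le_add_sq_of_mul_eq (hx j) (hy k) h0 (norm_nonneg _) ?_
      have e1 : x j * (‖⟪T (u j), D (v k)⟫_ℂ‖ / x j) = ‖⟪T (u j), D (v k)⟫_ℂ‖ := by
        refine mul_div_cancel_of_imp' fun h => ?_
        have : T (u j) = 0 := by rw [← norm_eq_zero, hTn, h]
        simp [this]
      have e2 : y k * (‖⟪T' (v k), D (u j)⟫_ℂ‖ / y k) = ‖⟪D (u j), T' (v k)⟫_ℂ‖ := by
        rw [norm_inner_symm (D (u j))]
        refine mul_div_cancel_of_imp' fun h => ?_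
        have : T' (v k) = 0 := by rw [← norm_eq_zero, hTn', h]
        simp [this]
      have e3 : ((x j + y k : ℝ) : ℂ) * ⟪u j, (X - Y) (v k)⟫_ℂ =
          ⟪T (u j), D (v k)⟫_ℂ + ⟪D (u j), T' (v k)⟫_ℂ := by
        have a1 : ⟪T (u j), T (v k)⟫_ℂ = (x j : ℂ) ^ 2 * ⟪u j, v k⟫_ℂ := by
          rw [gram hX hXT, ← hX.inner_left_eq_inner_right, hu, map_smul, hu,
            inner_smul_left, inner_smul_left, Complex.conj_ofReal]
          ring
        have a2 : ⟪T' (u j), T' (v k)⟫_ℂ = (y k : ℂ) ^ 2 * ⟪u j, v k⟫_ℂ := by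
          rw [gram hY hYT, hY.inner_left_eq_inner_right, hv, map_smul, hv,
            inner_smul_right, inner_smul_right]
          ring
        simp only [hD, sub_apply, inner_sub_right, inner_sub_left] at hs ⊢
        rw [hs, a1, a2]
        push_cast
        ring
      rw [e1, e2]
      calc (x j + y k) * ‖⟪u j, (X - Y) (v k)⟫_ℂ‖
          = ‖((x j + y k : ℝ) : ℂ) * ⟪u j, (X - Y) (v k)⟫_ℂ‖ := by
            rw [norm_mul, Complex.norm_real, Real.norm_of_nonneg h0.le]
        _ ≤ _ := by rw [e3]; exact norm_add_le _ _
  calc ∑ i, ‖(X - Y) (b i)‖ ^ 2 = ∑ k, ‖(X - Y) (v k)‖ ^ 2 := b.sum_norm_sq_apply_eq v _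
    _ = ∑ k, ∑ j, ‖⟪u j, (X - Y) (v k)⟫_ℂ‖ ^ 2 := by simp only [u.sum_sq_norm_inner_right]
    _ ≤ ∑ k, ∑ j, ((‖⟪T (u j), D (v k)⟫_ℂ‖ / x j) ^ 2 + (‖⟪T' (v k), D (u j)⟫_ℂ‖ / y k) ^ 2) := by
      gcongr; exact entry _ _
    _ = ∑ k, ∑ j, (‖⟪T (u j), D (v k)⟫_ℂ‖ / x j) ^ 2 +
          ∑ j, ∑ k, (‖⟪T' (v k), D (u j)⟫_ℂ‖ / y k) ^ 2 := by
      rw [Finset.sum_comm (s := Finset.univ (α := Fin _))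
        (f := fun j k => (‖⟪T' (v k), D (u j)⟫_ℂ‖ / y k) ^ 2)]
      simp only [Finset.sum_add_distrib]
    _ ≤ ∑ k, ‖D (v k)‖ ^ 2 + ∑ j, ‖D (u j)‖ ^ 2 := by
      gcongr
      · exact sum_norm_inner_div_sq_le _ _ (orth hX hXT hu) hTn _
      · exact sum_norm_inner_div_sq_le _ _ (orth hY hYT hv) hTn' _
    _ = 2 * ∑ i, ‖D (b i)‖ ^ 2 := by
      rw [b.sum_norm_sq_apply_eq v D, u.sum_norm_sq_apply_eq v D, two_mul]

end FiniteDimensional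

section StrongConvergence

variable {H : Type*} [NormedAddCommGroup H] [InnerProductSpace ℂ H]
  {κ : Type*} {l : Filter κ} {A : κ → H →L[ℂ] H} {B : H →L[ℂ] H} {R : ℝ}

lemma tendsto_pow_apply (hR : ∀ i, ‖A i‖ ≤ R) (h : ∀ x, Tendsto (fun i => A i x) l (𝓝 (B x)))
    (n : ℕ) (x : H) : Tendsto (fun i => (A i ^ n) x) l (𝓝 ((B ^ n) x)) := by
  induction n with
  | zero => simpa using tendsto_const_nhds
  | succ n ih =>
    have h1 : Tendsto (fun i => A i ((A i ^ n) x - (B ^ n) x)) l (𝓝 0) := by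
      have h2 : Tendsto (fun i => R * ‖(A i ^ n) x - (B ^ n) x‖) l (𝓝 0) := by
        simpa using (tendsto_iff_norm_sub_tendsto_zero.1 ih).const_mul R
      exact squeeze_zero_norm (fun i => (A i).le_of_opNorm_le (hR i) _) h2
    simpa [pow_succ'] using h1.add (h ((B ^ n) x))

lemma tendsto_aeval_apply (hR : ∀ i, ‖A i‖ ≤ R) (h : ∀ x, Tendsto (fun i => A i x) l (𝓝 (B x)))
    (q : Polynomial ℝ) (x : H) :
    Tendsto (fun i => Polynomial.aeval (A i) q x) l (𝓝 (Polynomial.aeval B q x)) := by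
  simp only [Polynomial.aeval_eq_sum_range, sum_apply,
    smul_apply]
  exact tendsto_finsetSum _ fun n _ => (tendsto_pow_apply hR h n x).const_smul _

/-- The continuous functional calculus is strongly continuous on bounded sets of self-adjoint
operators. -/
theorem tendsto_cfc_apply [CompleteSpace H] {f : ℝ → ℝ} (hf : Continuous f) (hA : ∀ i, IsSelfAdjoint (A i))
    (hB : IsSelfAdjoint B) (hR : ∀ i, ‖A i‖ ≤ R) (hBR : ‖B‖ ≤ R)
    (h : ∀ x, Tendsto (fun i => A i x) l (𝓝 (B x))) (x : H) :
    Tendsto (fun i => cfc f (A i) x) l (𝓝 (cfc f B x)) := by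
  rw [Metric.tendsto_nhds]
  intro ε hε
  obtain ⟨δ, hδ, hδε⟩ : ∃ δ > 0, δ * ‖x‖ + δ * ‖x‖ + δ ≤ ε := by
    refine ⟨ε / (2 * ‖x‖ + 1), by positivity, le_of_eq ?_⟩
    field_simp
    ring
  obtain ⟨q, hq⟩ := exists_polynomial_near_of_continuousOn (-R) R f hf.continuousOn δ hδ
  have hclose {C : H →L[ℂ] H} (hC : IsSelfAdjoint C) (hCR : ‖C‖ ≤ R) :
      ‖cfc f C x - Polynomial.aeval C q x‖ ≤ δ * ‖x‖ := by
    rw [← sub_apply]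
    refine ContinuousLinearMap.le_of_opNorm_le _ ?_ x
    rw [← cfc_polynomial q C, ← cfc_sub f q.eval C hf.continuousOn q.continuousOn]
    refine norm_cfc_le hδ.le fun t ht => ?_
    have ht' : |t| ≤ R := by
      have h1 := spectrum.subset_closedBall_norm_mul C ht
      rw [mem_closedBall_zero_iff, Real.norm_eq_abs] at h1
      exact (h1.trans (mul_le_of_le_one_right (norm_nonneg _)
        ContinuousLinearMap.norm_id_le)).trans hCR
    rw [norm_sub_rev]
    exact (hq t (abs_le.1 ht')).le
  filter_upwards [Metric.tendsto_nhds.1 (tendsto_aeval_apply hR h q x) δ hδ] with i hi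
  rw [dist_eq_norm] at hi ⊢
  calc ‖cfc f (A i) x - cfc f B x‖
      = ‖(cfc f (A i) x - Polynomial.aeval (A i) q x) - (cfc f B x - Polynomial.aeval B q x) +
          (Polynomial.aeval (A i) q x - Polynomial.aeval B q x)‖ := by congr 1; abel
    _ ≤ ‖cfc f (A i) x - Polynomial.aeval (A i) q x‖ + ‖cfc f B x - Polynomial.aeval B q x‖ +
          ‖Polynomial.aeval (A i) q x - Polynomial.aeval B q x‖ :=
      (norm_add_le _ _).trans (by gcongr; exact norm_sub_le _ _)
    _ < δ * ‖x‖ + δ * ‖x‖ + δ := by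
      linarith [hclose (hA i) (hR i), hclose hB hBR]
    _ ≤ ε := hδε

end StrongConvergence

section OpSqrt

variable {H W : Type*} [NormedAddCommGroup H] [InnerProductSpace ℂ H] [CompleteSpace H]
  [NormedAddCommGroup W] [InnerProductSpace ℂ W] [CompleteSpace W]

lemma opSqrt_eq_sqrt {A : H →L[ℂ] H} (hA : A.IsPositive) : opSqrt A = CFC.sqrt A := by
  have h0 : 0 ≤ A := (ContinuousLinearMap.nonneg_iff_isPositive A).2 hA
  rw [CFC.sqrt_eq_real_sqrt A, cfcₙ_eq_cfc, opSqrt]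

lemma isPositive_opSqrt {A : H →L[ℂ] H} (hA : A.IsPositive) : (opSqrt A).IsPositive := by
  rw [opSqrt_eq_sqrt hA, ← ContinuousLinearMap.nonneg_iff_isPositive]
  exact CFC.sqrt_nonneg A

lemma opSqrt_comp_self {A : H →L[ℂ] H} (hA : A.IsPositive) : opSqrt A ∘L opSqrt A = A := by
  rw [opSqrt_eq_sqrt hA]
  exact CFC.sqrt_mul_sqrt_self A ((ContinuousLinearMap.nonneg_iff_isPositive A).2 hA)

lemma opSqrt_eq_of_comp_self {A B : H →L[ℂ] H} (hB : B.IsPositive) (h : B ∘L B = A) :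
    opSqrt A = B := by
  have hA : A.IsPositive := by
    have := ContinuousLinearMap.isPositive_adjoint_comp_self B
    rwa [hB.isSelfAdjoint.adjoint_eq, h] at this
  rw [opSqrt_eq_sqrt hA]
  exact CFC.sqrt_unique h ((ContinuousLinearMap.nonneg_iff_isPositive B).2 hB)

/-- The square root of the compression of `T† T` to a closed subspace `U`. -/
lemma opSqrt_compression (U : Submodule ℂ H) [CompleteSpace U] (T : H →L[ℂ] W) :
    opSqrt (U.starProjection ∘L (T† ∘L T) ∘L U.starProjection) =
      U.subtypeL ∘L opSqrt ((T ∘L U.subtypeL)† ∘L (T ∘L U.subtypeL)) ∘L U.subtypeL† := by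
  set S := T ∘L U.subtypeL
  have hS := ContinuousLinearMap.isPositive_adjoint_comp_self S
  refine opSqrt_eq_of_comp_self ((isPositive_opSqrt hS).conj_adjoint U.subtypeL) ?_
  have hpos := opSqrt_comp_self hS
  ext x
  have h1 (w : U) : (U.subtypeL†) (U.subtypeL w) = w := by
    rw [U.adjoint_subtypeL]; simp
  simp only [ContinuousLinearMap.comp_apply, h1]
  rw [← ContinuousLinearMap.comp_apply (opSqrt _) (opSqrt _), hpos]
  simp [S, ContinuousLinearMap.adjoint_comp, U.adjoint_subtypeL]

/-- Araki–Yamagami: if `T - T'` is Hilbert–Schmidt then so is `|T| - |T'|`. -/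
theorem summable_norm_sq_opSqrt_sub {T T' : H →L[ℂ] W} {ι : Type*} (e : HilbertBasis ι ℂ H)
    (h : Summable fun i => ‖(T - T') (e i)‖ ^ 2) :
    Summable fun i => ‖(opSqrt (T† ∘L T) - opSqrt (T'† ∘L T')) (e i)‖ ^ 2 := by
  classical
  let U (F : Finset ι) : Submodule ℂ H := Submodule.span ℂ (F.image e : Set H)
  have hU : Monotone U := fun F G hFG => Submodule.span_mono <| by
    exact_mod_cast Finset.image_subset_image hFG
  have hproj (x : H) : Tendsto (fun F => (U F).starProjection x) atTop (𝓝 x) :=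
    Submodule.starProjection_tendsto_self U hU x e.finite_spans_dense.ge
  let c (S : H →L[ℂ] W) (F : Finset ι) : H →L[ℂ] H :=
    (U F).starProjection ∘L (S† ∘L S) ∘L (U F).starProjection
  have hc (S : H →L[ℂ] W) (x : H) :
      Tendsto (fun F => opSqrt (c S F) x) atTop (𝓝 (opSqrt (S† ∘L S) x)) := by
    have hpos := ContinuousLinearMap.isPositive_adjoint_comp_self S
    have hle (F : Finset ι) : ‖(U F).starProjection‖ ≤ 1 := Submodule.starProjection_norm_le _
    refine tendsto_cfc_apply (R := ‖S† ∘L S‖) Real.continuous_sqrt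
      (fun F => (hpos.conj_starProjection (U F)).isSelfAdjoint) hpos.isSelfAdjoint
      (fun F => ?_) le_rfl (fun y => ?_) x
    · calc ‖c S F‖ ≤ ‖(U F).starProjection‖ * (‖S† ∘L S‖ * ‖(U F).starProjection‖) :=
            (ContinuousLinearMap.opNorm_comp_le _ _).trans
              (by gcongr; exact ContinuousLinearMap.opNorm_comp_le _ _)
        _ ≤ 1 * (‖S† ∘L S‖ * 1) := by gcongr <;> exact hle F
        _ = ‖S† ∘L S‖ := by ring
    · set z := (S† ∘L S) y
      have h1 : Tendsto (fun F => (U F).starProjection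
          ((S† ∘L S) ((U F).starProjection y) - z)) atTop (𝓝 0) := by
        have h2 : Tendsto (fun F => (S† ∘L S) ((U F).starProjection y)) atTop (𝓝 z) :=
          ((S† ∘L S).continuous.tendsto y).comp (hproj y)
        refine squeeze_zero_norm (fun F => ?_) (tendsto_iff_norm_sub_tendsto_zero.1 h2)
        simpa only [one_mul] using (U F).starProjection.le_of_opNorm_le (hle F) _
      simpa [c] using h1.add (hproj z)
  have hbound (F : Finset ι) : ∑ i ∈ F, ‖(opSqrt (c T F) - opSqrt (c T' F)) (e i)‖ ^ 2 ≤
      2 * ∑' i, ‖(T - T') (e i)‖ ^ 2 := by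
    let J := (U F).subtypeL
    let b : OrthonormalBasis F ℂ (U F) := OrthonormalBasis.span e.orthonormal F
    have hb (i : F) : J (b i) = e i := OrthonormalBasis.span_apply e.orthonormal F i
    have hJ (w : U F) : (J†) (J w) = w := by
      rw [Submodule.adjoint_subtypeL]; simp [J]
    have hpos (S : H →L[ℂ] W) := ContinuousLinearMap.isPositive_adjoint_comp_self (S ∘L J)
    have key := sum_norm_sq_sub_le_of_sq_eq (isPositive_opSqrt (hpos T))
      (isPositive_opSqrt (hpos T')) (opSqrt_comp_self (hpos T)) (opSqrt_comp_self (hpos T')) b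
    calc ∑ i ∈ F, ‖(opSqrt (c T F) - opSqrt (c T' F)) (e i)‖ ^ 2
        = ∑ i : F, ‖(opSqrt (c T F) - opSqrt (c T' F)) (e i)‖ ^ 2 :=
          (Finset.sum_coe_sort F fun i => ‖(opSqrt (c T F) - opSqrt (c T' F)) (e i)‖ ^ 2).symm
      _ = ∑ i : F, ‖(opSqrt ((T ∘L J)† ∘L (T ∘L J)) -
            opSqrt ((T' ∘L J)† ∘L (T' ∘L J))) (b i)‖ ^ 2 := by
          refine Finset.sum_congr rfl fun i _ => ?_
          congr 1
          have e1 (S : H →L[ℂ] W) : opSqrt (c S F) (e i) =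
              J (opSqrt ((S ∘L J)† ∘L (S ∘L J)) (b i)) := by
            rw [← hb i]
            simp only [c, opSqrt_compression, ContinuousLinearMap.comp_apply]
            rw [hJ]
          rw [sub_apply, sub_apply, e1, e1, ← map_sub]
          rfl
      _ ≤ 2 * ∑ i : F, ‖(T ∘L J - T' ∘L J) (b i)‖ ^ 2 := key
      _ = 2 * ∑ i ∈ F, ‖(T - T') (e i)‖ ^ 2 := by
          rw [← Finset.sum_coe_sort F fun i => ‖(T - T') (e i)‖ ^ 2]
          simp [hb]
      _ ≤ _ := by
          gcongr
          exact h.sum_le_tsum F fun i _ => by positivity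
  refine summable_of_sum_le (c := 2 * ∑' i, ‖(T - T') (e i)‖ ^ 2) (fun i => by positivity)
    fun G => ?_
  have hlim : Tendsto (fun F => ∑ i ∈ G, ‖(opSqrt (c T F) - opSqrt (c T' F)) (e i)‖ ^ 2) atTop
      (𝓝 (∑ i ∈ G, ‖(opSqrt (T† ∘L T) - opSqrt (T'† ∘L T')) (e i)‖ ^ 2)) :=
    tendsto_finsetSum _ fun i _ => (((hc T (e i)).sub (hc T' (e i))).norm.pow 2)
  refine le_of_tendsto hlim ?_
  filter_upwards [eventually_ge_atTop G] with F hGF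
  exact (Finset.sum_le_sum_of_subset_of_nonneg hGF fun i _ _ => by positivity).trans (hbound F)

end OpSqrt

section HilbertSchmidt

variable {H W : Type*} [NormedAddCommGroup H] [InnerProductSpace ℂ H] [CompleteSpace H]
  [NormedAddCommGroup W] [InnerProductSpace ℂ W] [CompleteSpace W]

lemma HilbertBasis.hasSum_norm_inner_sq {H : Type*} [NormedAddCommGroup H]
    [InnerProductSpace ℂ H] {ι : Type*} (e : HilbertBasis ι ℂ H) (x : H) :
    HasSum (fun i => ‖⟪e i, x⟫_ℂ‖ ^ 2) (‖x‖ ^ 2) := by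
  have h := (e.hasSum_inner_mul_inner x x).mapL Complex.reCLM
  convert! h using 1
  · ext i
    rw [← inner_conj_symm x, Complex.reCLM_apply, ← Complex.normSq_eq_conj_mul_self,
      Complex.ofReal_re, Complex.normSq_eq_norm_sq]
  · rw [inner_self_eq_norm_sq_to_K]
    norm_cast

lemma summable_norm_sq_adjoint {ι κ : Type*} (e : HilbertBasis ι ℂ H) (f : HilbertBasis κ ℂ W)
    {A : H →L[ℂ] W} (h : Summable fun i => ‖A (e i)‖ ^ 2) :
    Summable fun k => ‖(A†) (f k)‖ ^ 2 := by
  have h1 : Summable fun p : ι × κ => ‖⟪f p.2, A (e p.1)⟫_ℂ‖ ^ 2 := by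
    have hnonneg : 0 ≤ fun p : ι × κ => ‖⟪f p.2, A (e p.1)⟫_ℂ‖ ^ 2 := fun p => sq_nonneg _
    rw [summable_prod_of_nonneg hnonneg]
    have hrow (i : ι) := f.hasSum_norm_inner_sq (A (e i))
    exact ⟨fun i => (hrow i).summable, h.congr fun i => (hrow i).tsum_eq.symm⟩
  refine h1.prod_symm.prod.congr fun k => ?_
  rw [← (e.hasSum_norm_inner_sq _).tsum_eq]
  refine tsum_congr fun i => ?_
  rw [ContinuousLinearMap.adjoint_inner_right, norm_inner_symm]
  rfl

end HilbertSchmidt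

/-- If `√A - √B` is Hilbert–Schmidt, so is `√(M† B M) - √(M† A M)`. -/
theorem IsHilbertSchmidt.opSqrt_conj_sub {H : Type u} {K : Type v}
    [NormedAddCommGroup H] [InnerProductSpace ℂ H] [CompleteSpace H]
    [NormedAddCommGroup K] [InnerProductSpace ℂ K] [CompleteSpace K]
    {A B : H →L[ℂ] H} (hA : A.IsPositive) (hB : B.IsPositive)
    (h : IsHilbertSchmidt (opSqrt A - opSqrt B)) (M : K →L[ℂ] H) :
    IsHilbertSchmidt (opSqrt (M† ∘L B ∘L M) - opSqrt (M† ∘L A ∘L M)) := by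
  obtain ⟨ι, e, he⟩ := h
  obtain ⟨s, f, -⟩ := exists_hilbertBasis ℂ K
  refine ⟨s, f, ?_⟩
  have hconj {C : H →L[ℂ] H} (hC : C.IsPositive) :
      M† ∘L C ∘L M = (opSqrt C ∘L M)† ∘L (opSqrt C ∘L M) := by
    rw [ContinuousLinearMap.adjoint_comp, (isPositive_opSqrt hC).isSelfAdjoint.adjoint_eq]
    conv_lhs => rw [← opSqrt_comp_self hC]
    rfl
  rw [hconj hA, hconj hB]
  refine summable_norm_sq_opSqrt_sub f ?_
  set S := opSqrt B - opSqrt A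
  have hS : S† = S :=
    ((isPositive_opSqrt hB).isSelfAdjoint.sub (isPositive_opSqrt hA).isSelfAdjoint).adjoint_eq
  have h1 : Summable fun i => ‖(M† ∘L S) (e i)‖ ^ 2 := by
    refine Summable.of_nonneg_of_le (fun i => by positivity) (fun i => ?_) (he.mul_left (‖M†‖ ^ 2))
    rw [← mul_pow, ContinuousLinearMap.comp_apply]
    gcongr
    refine ((M†).le_opNorm _).trans (le_of_eq ?_)
    simp only [S, sub_apply]
    rw [norm_sub_rev]
  have h2 := summable_norm_sq_adjoint e f h1
  rw [ContinuousLinearMap.adjoint_comp, ContinuousLinearMap.adjoint_adjoint, hS] at h2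
  exact h2

/-- A skew-adjoint contraction `R` has `1 - iR` positive. -/
lemma isPositive_one_sub_I_smul {H : Type*} [NormedAddCommGroup H] [InnerProductSpace ℂ H]
    [CompleteSpace H] {R : H →L[ℂ] H} (hR : R† = -R) (hn : ‖R‖ ≤ 1) :
    (1 - Complex.I • R).IsPositive := by
  refine ContinuousLinearMap.isPositive_def'.2 ⟨?_, fun x => ?_⟩
  · rw [ContinuousLinearMap.isSelfAdjoint_iff', map_sub, LinearIsometryEquiv.map_smulₛₗ, hR,
      ContinuousLinearMap.one_def, ContinuousLinearMap.adjoint_id]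
    simp
  · rw [ContinuousLinearMap.reApplyInnerSelf_apply]
    simp only [sub_apply, one_apply_eq_self, inner_sub_left,
      map_sub, inner_self_eq_norm_sq, smul_apply]
    have h1 : RCLike.re ⟪Complex.I • R x, x⟫_ℂ ≤ ‖x‖ ^ 2 := by
      refine (RCLike.re_le_norm _).trans ((norm_inner_le_norm _ _).trans ?_)
      rw [norm_smul, Complex.norm_I, one_mul, sq]
      gcongr
      simpa using R.le_of_opNorm_le hn x
    linarith

/-- Symmetry of the Hilbert–Schmidt excitability condition under exchanging the two states:
with `R₂ := (L⁻¹)† R₁ L⁻¹`, `Q := L† L`, `Q' := (L⁻¹)† L⁻¹`, the operators `Q - iR₁`, `1 - iR₁`,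
`Q' - iR₂`, `1 - iR₂` are positive (and `R₂† = -R₂`, `L† R₂ L = R₁`), and if
`√(Q - iR₁) - √(1 - iR₁)` is Hilbert–Schmidt then so is `√(Q' - iR₂) - √(1 - iR₂)`. -/
theorem oneWay_excitability_symmetric
    {K₁ : Type u} {K₂ : Type v}
    [NormedAddCommGroup K₁] [InnerProductSpace ℂ K₁] [CompleteSpace K₁]
    [NormedAddCommGroup K₂] [InnerProductSpace ℂ K₂] [CompleteSpace K₂]
    (L : K₁ ≃L[ℂ] K₂)
    (R₁ : K₁ →L[ℂ] K₁) (hR₁adj : ContinuousLinearMap.adjoint R₁ = -R₁) (hR₁norm : ‖R₁‖ ≤ 1)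
    (R₂ : K₂ →L[ℂ] K₂)
    (hR₂def : R₂ = ContinuousLinearMap.adjoint (L.symm : K₂ →L[ℂ] K₁) ∘L R₁ ∘L
      (L.symm : K₂ →L[ℂ] K₁))
    (hR₂norm : ‖R₂‖ ≤ 1)
    (Q : K₁ →L[ℂ] K₁)
    (hQ : Q = ContinuousLinearMap.adjoint (L : K₁ →L[ℂ] K₂) ∘L (L : K₁ →L[ℂ] K₂))
    (Q' : K₂ →L[ℂ] K₂)
    (hQ' : Q' = ContinuousLinearMap.adjoint (L.symm : K₂ →L[ℂ] K₁) ∘L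
      (L.symm : K₂ →L[ℂ] K₁)) :
    ContinuousLinearMap.adjoint R₂ = -R₂ ∧
      ContinuousLinearMap.adjoint (L : K₁ →L[ℂ] K₂) ∘L R₂ ∘L (L : K₁ →L[ℂ] K₂) = R₁ ∧
      (Q - Complex.I • R₁).IsPositive ∧ (1 - Complex.I • R₁ : K₁ →L[ℂ] K₁).IsPositive ∧
      (Q' - Complex.I • R₂).IsPositive ∧ (1 - Complex.I • R₂ : K₂ →L[ℂ] K₂).IsPositive ∧
      (IsHilbertSchmidt (opSqrt (Q - Complex.I • R₁) - opSqrt (1 - Complex.I • R₁)) →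
        IsHilbertSchmidt (opSqrt (Q' - Complex.I • R₂) - opSqrt (1 - Complex.I • R₂))) := by
  have hR₂adj : R₂† = -R₂ := by
    rw [hR₂def, ContinuousLinearMap.adjoint_comp, ContinuousLinearMap.adjoint_comp,
      ContinuousLinearMap.adjoint_adjoint, hR₁adj]
    ext x
    simp
  have hP₁ := isPositive_one_sub_I_smul hR₁adj hR₁norm
  have hP₂ := isPositive_one_sub_I_smul hR₂adj hR₂norm
  have hLL : (L.symm : K₂ →L[ℂ] K₁) ∘L (L : K₁ →L[ℂ] K₂) = .id ℂ K₁ := by ext x; simp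
  have hLadj (z : K₁) : ((L : K₁ →L[ℂ] K₂)†) (((L.symm : K₂ →L[ℂ] K₁)†) z) = z := by
    rw [← ContinuousLinearMap.comp_apply, ← ContinuousLinearMap.adjoint_comp, hLL,
      ContinuousLinearMap.adjoint_id, ContinuousLinearMap.id_apply]
  have hLR : (L : K₁ →L[ℂ] K₂)† ∘L R₂ ∘L (L : K₁ →L[ℂ] K₂) = R₁ := by
    ext x
    simp [hR₂def, hLadj]
  have hA₁ : Q - Complex.I • R₁ =
      (L : K₁ →L[ℂ] K₂)† ∘L (1 - Complex.I • R₂) ∘L (L : K₁ →L[ℂ] K₂) := by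
    rw [← hLR, hQ]
    ext x
    simp
  have hA₂ : Q' - Complex.I • R₂ =
      (L.symm : K₂ →L[ℂ] K₁)† ∘L (1 - Complex.I • R₁) ∘L (L.symm : K₂ →L[ℂ] K₁) := by
    rw [hR₂def, hQ']
    ext x
    simp
  have hB₂ : 1 - Complex.I • R₂ =
      (L.symm : K₂ →L[ℂ] K₁)† ∘L (Q - Complex.I • R₁) ∘L (L.symm : K₂ →L[ℂ] K₁) := by
    have hLL' : (L : K₁ →L[ℂ] K₂) ∘L (L.symm : K₂ →L[ℂ] K₁) = .id ℂ K₂ := by ext x; simp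
    have hLadj' (z : K₂) : ((L.symm : K₂ →L[ℂ] K₁)†) (((L : K₁ →L[ℂ] K₂)†) z) = z := by
      rw [← ContinuousLinearMap.comp_apply, ← ContinuousLinearMap.adjoint_comp, hLL',
        ContinuousLinearMap.adjoint_id, ContinuousLinearMap.id_apply]
    rw [hA₁]
    ext x
    simp [hLadj']
  have hPA₁ : (Q - Complex.I • R₁).IsPositive := hA₁ ▸ hP₂.adjoint_conj _
  have hPA₂ : (Q' - Complex.I • R₂).IsPositive := hA₂ ▸ hP₁.adjoint_conj _
  refine ⟨hR₂adj, hLR, hPA₁, hP₁, hPA₂, hP₂, fun h => ?_⟩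
  rw [hA₂, hB₂]
  exact h.opSqrt_conj_sub hPA₁ hP₁ _
end
end

section
/- Let H be the Hilbert space direct sum ℓ²(ℕ, ℂ) ⊕ ℓ²(ℕ, ℂ). Define bounded operators X₁ and X₂ on H by X₁(x, y) := (2·x, 0), and X₂(x, y) := (((2 + 1/(n+1))·x n)_{n}, ((1/(n+1))·y n)_{n}). Then X₁ and X₂ are positive bounded operators, X₂ − X₁ is Hilbert–Schmidt, but √X₂ − √X₁ is not Hilbert–Schmidt. -/
noncomputable section

universe u v w

/-- The Hilbert space `ℓ²(ℕ, ℂ) ⊕ ℓ²(ℕ, ℂ)`, realized as `ℓ²` over the index type `ℕ ⊕ ℕ`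
(the two summands corresponding to `Sum.inl` and `Sum.inr`). -/
abbrev DoubleL2 : Type := lp (fun _ : ℕ ⊕ ℕ => ℂ) 2

open scoped InnerProductSpace

section Parseval

variable {E : Type*} [NormedAddCommGroup E] [InnerProductSpace ℂ E]

theorem HilbertBasis.hasSum_sq_norm_inner {ι : Type*} (b : HilbertBasis ι ℂ E) (x : E) :
    HasSum (fun i => ‖⟪b i, x⟫_ℂ‖ ^ 2) (‖x‖ ^ 2) := by
  have h := Complex.hasSum_re (b.hasSum_inner_mul_inner x x)
  convert h using 1
  · funext i
    rw [← inner_conj_symm x (b i), ← Complex.normSq_eq_conj_mul_self, Complex.normSq_eq_norm_sq,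
      Complex.ofReal_re]
  · rw [inner_self_eq_norm_sq_to_K]
    norm_cast

/-- Square-summability of `‖T (b i)‖` passes to the adjoint, in any other Hilbert basis. -/
theorem summable_sq_norm_adjoint [CompleteSpace E] {F : Type*} [NormedAddCommGroup F]
    [InnerProductSpace ℂ F] [CompleteSpace F] {ι κ : Type*} (b : HilbertBasis ι ℂ E)
    (e : HilbertBasis κ ℂ F) (T : E →L[ℂ] F) (h : Summable fun i => ‖T (b i)‖ ^ 2) :
    Summable fun j => ‖T.adjoint (e j)‖ ^ 2 := by
  have hprod : Summable fun p : ι × κ => ‖⟪e p.2, T (b p.1)⟫_ℂ‖ ^ 2 := by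
    refine (summable_prod_of_nonneg fun p => by positivity).2
      ⟨fun i => (e.hasSum_sq_norm_inner (T (b i))).summable, ?_⟩
    simpa only [(e.hasSum_sq_norm_inner _).tsum_eq] using h
  refine ((summable_prod_of_nonneg fun p => by positivity).1 hprod.prod_symm).2.congr fun j => ?_
  rw [← (b.hasSum_sq_norm_inner (T.adjoint (e j))).tsum_eq]
  refine tsum_congr fun i => ?_
  rw [ContinuousLinearMap.adjoint_inner_right, norm_inner_symm]
  rfl

theorem IsHilbertSchmidt.summable_of_isSelfAdjoint {E : Type u} [NormedAddCommGroup E]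
    [InnerProductSpace ℂ E] [CompleteSpace E] {T : E →L[ℂ] E} (hT : IsHilbertSchmidt T)
    (hsa : IsSelfAdjoint T) {κ : Type*} (e : HilbertBasis κ ℂ E) :
    Summable fun j => ‖T (e j)‖ ^ 2 := by
  obtain ⟨ι, b, hb⟩ := hT
  simpa only [hsa.adjoint_eq] using summable_sq_norm_adjoint b e T hb

end Parseval

section Sqrt

variable {H : Type u} [NormedAddCommGroup H] [InnerProductSpace ℂ H] [CompleteSpace H]

theorem opSqrt_isPositive (A : H →L[ℂ] H) : (opSqrt A).IsPositive :=
  (ContinuousLinearMap.nonneg_iff_isPositive _).1 (cfc_nonneg fun x _ => Real.sqrt_nonneg x)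

theorem opSqrt_mul_self {A : H →L[ℂ] H} (hA : A.IsPositive) : opSqrt A * opSqrt A = A := by
  have h0 : 0 ≤ A := (ContinuousLinearMap.nonneg_iff_isPositive _).2 hA
  rw [opSqrt, ← cfc_mul Real.sqrt Real.sqrt A]
  conv_rhs => rw [← cfc_id ℝ A hA.isSelfAdjoint]
  exact cfc_congr fun x hx => Real.mul_self_sqrt (spectrum_nonneg_of_nonneg h0 hx)

theorem opSqrt_apply_eigenvector {A : H →L[ℂ] H} (hA : A.IsPositive) {r : ℝ} (hr : 0 ≤ r) {v : H}
    (hv : A v = (r : ℂ) • v) : opSqrt A v = ((√r : ℝ) : ℂ) • v := by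
  have hS := opSqrt_isPositive A
  have hSS : opSqrt A (opSqrt A v) = (r : ℂ) • v := by
    rw [← hv, ← mul_apply_eq_comp, opSqrt_mul_self hA]
  rcases hr.eq_or_lt with rfl | hr
  · have h : ⟪opSqrt A v, opSqrt A v⟫_ℂ = 0 := by
      rw [hS.inner_left_eq_inner_right, hSS]
      simp
    simpa using h
  · set w := opSqrt A v - ((√r : ℝ) : ℂ) • v with hw
    have hSw : opSqrt A w = -((√r : ℝ) : ℂ) • w := by
      have hrr : (r : ℂ) = ((√r : ℝ) : ℂ) * ((√r : ℝ) : ℂ) := by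
        rw [← Complex.ofReal_mul, Real.mul_self_sqrt hr.le]
      rw [hw, map_sub, map_smul, hSS, hrr]
      module
    have h := hS.re_inner_nonneg_right w
    rw [hSw, inner_smul_right, inner_self_eq_norm_sq_to_K] at h
    have h' : 0 ≤ -(√r * ‖w‖ ^ 2) := by
      have h2 : -((√r : ℝ) : ℂ) * ((‖w‖ : ℝ) : ℂ) ^ 2 = ((-(√r * ‖w‖ ^ 2) : ℝ) : ℂ) := by
        push_cast; ring
      simpa only [Complex.coe_algebraMap, h2, RCLike.re_to_complex, Complex.ofReal_re] using h
    have hw0 : ‖w‖ ^ 2 = 0 := by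
      have := Real.sqrt_pos.2 hr
      nlinarith [sq_nonneg ‖w‖]
    exact sub_eq_zero.1 (norm_eq_zero.1 (pow_eq_zero_iff two_ne_zero |>.1 hw0))

end Sqrt

section Diagonal

variable {ι : Type*}

/-- The standard Hilbert basis of `ℓ²(ι, ℂ)`. -/
def stdHilbertBasis (ι : Type*) : HilbertBasis ι ℂ (lp (fun _ : ι => ℂ) 2) :=
  .ofRepr (.refl ℂ _)

theorem stdHilbertBasis_apply [DecidableEq ι] (i j : ι) :
    stdHilbertBasis ι i j = if j = i then 1 else 0 := by
  rw [← (stdHilbertBasis ι).repr_symm_single i]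
  change lp.single (E := fun _ : ι => ℂ) 2 i 1 j = _
  rw [lp.single_apply, Pi.single_apply]

variable {X : lp (fun _ : ι => ℂ) 2 →L[ℂ] lp (fun _ : ι => ℂ) 2} {d : ι → ℝ}

theorem isPositive_of_diagonal (hX : ∀ w i, X w i = (d i : ℂ) * w i) (hd : ∀ i, 0 ≤ d i) :
    X.IsPositive := by
  rw [ContinuousLinearMap.isPositive_iff_complex]
  intro w
  have h : HasSum (fun i => ((d i * ‖w i‖ ^ 2 : ℝ) : ℂ)) ⟪X w, w⟫_ℂ := by
    refine (lp.hasSum_inner (X w) w).congr_fun fun i => ?_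
    rw [hX, RCLike.inner_apply, map_mul, Complex.conj_ofReal, mul_left_comm, Complex.mul_conj']
    push_cast
    rfl
  have hre := Complex.hasSum_re h
  simp only [Complex.ofReal_re] at hre
  exact ⟨(Complex.hasSum_ofReal.2 hre).unique h,
    hre.nonneg fun i => mul_nonneg (hd i) (sq_nonneg _)⟩

theorem diagonal_apply_stdHilbertBasis (hX : ∀ w i, X w i = (d i : ℂ) * w i) (i : ι) :
    X (stdHilbertBasis ι i) = (d i : ℂ) • stdHilbertBasis ι i := by
  classical
  ext j
  rw [hX, lp.coeFn_smul, Pi.smul_apply, smul_eq_mul, stdHilbertBasis_apply]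
  split_ifs with h
  · rw [h]
  · simp

end Diagonal

/-- Counterexample: `X₁(x, y) = (2x, 0)` and `X₂(x, y) = (((2 + 1/(n+1)) xₙ)ₙ, ((1/(n+1)) yₙ)ₙ)`
are positive, `X₂ - X₁` is Hilbert–Schmidt, but `√X₂ - √X₁` is not Hilbert–Schmidt. -/
theorem counterexample_sqrt_not_hilbertSchmidt (X₁ X₂ : DoubleL2 →L[ℂ] DoubleL2)
    (hX₁l : ∀ (w : DoubleL2) (n : ℕ), X₁ w (Sum.inl n) = 2 * w (Sum.inl n))
    (hX₁r : ∀ (w : DoubleL2) (n : ℕ), X₁ w (Sum.inr n) = 0)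
    (hX₂l : ∀ (w : DoubleL2) (n : ℕ),
      X₂ w (Sum.inl n) = (2 + 1 / ((n : ℂ) + 1)) * w (Sum.inl n))
    (hX₂r : ∀ (w : DoubleL2) (n : ℕ),
      X₂ w (Sum.inr n) = (1 / ((n : ℂ) + 1)) * w (Sum.inr n)) :
    X₁.IsPositive ∧ X₂.IsPositive ∧ IsHilbertSchmidt (X₂ - X₁) ∧
      ¬ IsHilbertSchmidt (opSqrt X₂ - opSqrt X₁) := by
  set d₁ : ℕ ⊕ ℕ → ℝ := Sum.elim (fun _ => 2) (fun _ => 0)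
  set d₂ : ℕ ⊕ ℕ → ℝ := Sum.elim (fun n => 2 + 1 / ((n : ℝ) + 1)) (fun n => 1 / ((n : ℝ) + 1))
  have hX₁ : ∀ w i, X₁ w i = (d₁ i : ℂ) * w i := by
    rintro w (n | n)
    · simp [d₁, hX₁l]
    · simp [d₁, hX₁r]
  have hX₂ : ∀ w i, X₂ w i = (d₂ i : ℂ) * w i := by
    rintro w (n | n)
    · simp [d₂, hX₂l]
    · simp [d₂, hX₂r]
  have hd₁ : ∀ i, 0 ≤ d₁ i := by rintro (n | n) <;> simp [d₁]
  have hd₂ : ∀ i, 0 ≤ d₂ i := by 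
    rintro (n | n) <;> simp only [d₂, Sum.elim_inl, Sum.elim_inr] <;> positivity
  have hp₁ := isPositive_of_diagonal hX₁ hd₁
  have hp₂ := isPositive_of_diagonal hX₂ hd₂
  have hnorm : ∀ i, ‖stdHilbertBasis (ℕ ⊕ ℕ) i‖ = 1 := (stdHilbertBasis _).orthonormal.1
  refine ⟨hp₁, hp₂, ⟨ℕ ⊕ ℕ, stdHilbertBasis _, ?_⟩, fun hHS => ?_⟩
  · have hsq : Summable fun n : ℕ => (1 / ((n : ℝ) + 1)) ^ 2 := by
      have := (summable_nat_add_iff 1).2 (Real.summable_one_div_nat_pow.2 one_lt_two)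
      simpa [div_pow] using this
    have hcoef : ∀ i, ‖(X₂ - X₁) (stdHilbertBasis _ i)‖ ^ 2 = (d₂ i - d₁ i) ^ 2 := fun i => by
      rw [sub_apply, diagonal_apply_stdHilbertBasis hX₁, diagonal_apply_stdHilbertBasis hX₂,
        ← sub_smul, norm_smul, hnorm, mul_one, ← Complex.ofReal_sub, Complex.norm_real,
        Real.norm_eq_abs, sq_abs]
    simp only [hcoef]
    refine Summable.sum _ (hsq.congr fun n => ?_) (hsq.congr fun n => ?_) <;> simp [d₁, d₂]
  · have hsum := hHS.summable_of_isSelfAdjoint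
      ((opSqrt_isPositive X₂).isSelfAdjoint.sub (opSqrt_isPositive X₁).isSelfAdjoint)
      (stdHilbertBasis _)
    have hinr := hsum.comp_injective (Sum.inr_injective (α := ℕ) (β := ℕ))
    refine Real.not_summable_one_div_natCast ((summable_nat_add_iff 1).1 (hinr.congr fun n => ?_))
    have h : 0 ≤ 1 / ((n : ℝ) + 1) := by positivity
    rw [Function.comp_apply, sub_apply,
      opSqrt_apply_eigenvector hp₁ (hd₁ _) (diagonal_apply_stdHilbertBasis hX₁ _),
      opSqrt_apply_eigenvector hp₂ (hd₂ _) (diagonal_apply_stdHilbertBasis hX₂ _),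
      ← sub_smul, norm_smul, hnorm, mul_one, ← Complex.ofReal_sub, Complex.norm_real,
      Real.norm_eq_abs, sq_abs]
    simp only [d₁, d₂, Sum.elim_inr, Real.sqrt_zero, sub_zero, Real.sq_sqrt h, Nat.cast_add,
      Nat.cast_one]
end
end
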